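/- arXiv:1702.06711 — 2 statements merged into one kernel-verified Lean document; each statement's English description precedes it below -/
import Mathlib

section
/- Let G be a connected graph with vertices v_1,…,v_n and let H_1,…,H_n be connected graphs each having at least 2 vertices. Then Z_c(G⟨H_1, H_2, …, H_n⟩) = |V(G)| + Σ_{i=1}^{n} Z(H_i). -/
open SimpleGraph

variable {V : Type*} {α β : Type*}

/-- Vertices forced black starting from `B`. -/
inductive ZFClosure (G : SimpleGraph V) (B : Set V) : V → Prop
  | init {v : V} : v ∈ B → ZFClosure G B v
  | force {u v : V} : ZFClosure G B u → G.Adj u v →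
      (∀ w, G.Adj u w → w ≠ v → ZFClosure G B w) → ZFClosure G B v

/-- `B` is a zero forcing set of `G`. -/
def IsZFS (G : SimpleGraph V) (B : Set V) : Prop := ∀ v : V, ZFClosure G B v

/-- `B` is a connected zero forcing set of `G`. -/
def IsCZFS (G : SimpleGraph V) (B : Set V) : Prop :=
  IsZFS G B ∧ ∀ C : G.ConnectedComponent, (G.induce (B ∩ C.supp)).Connected

/-- The zero forcing number `Z(G)`. -/
noncomputable def zfNum (G : SimpleGraph V) : ℕ :=
  sInf {k | ∃ B : Set V, B.ncard = k ∧ IsZFS G B}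

/-- The connected zero forcing number `Z_c(G)`. -/
noncomputable def czfNum (G : SimpleGraph V) : ℕ :=
  sInf {k | ∃ B : Set V, B.ncard = k ∧ IsCZFS G B}

/-- One step of the color change rule. -/
def zfStep (G : SimpleGraph V) (S : Set V) : Set V :=
  S ∪ {w | ∃ b ∈ S, G.Adj b w ∧ ∀ x, G.Adj b x → x ∉ S → x = w}

/-- propagation time of `B` in `G`. -/
noncomputable def propTime (G : SimpleGraph V) (B : Set V) : ℕ :=
  sInf {t | (zfStep G)^[t] B = Set.univ}

/-- minimum connected propagation time. -/
noncomputable def minCPT (G : SimpleGraph V) : ℕ :=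
  sInf {t | ∃ B : Set V, IsCZFS G B ∧ B.ncard = czfNum G ∧ propTime G B = t}

/-- maximum connected propagation time. -/
noncomputable def maxCPT (G : SimpleGraph V) : ℕ :=
  sSup {t | ∃ B : Set V, IsCZFS G B ∧ B.ncard = czfNum G ∧ propTime G B = t}

/-- Strong product of graphs. -/
def StrongProd (G : SimpleGraph α) (H : SimpleGraph β) : SimpleGraph (α × β) :=
  SimpleGraph.fromRel (fun a b =>
    (a.1 = b.1 ∧ H.Adj a.2 b.2) ∨ (a.2 = b.2 ∧ G.Adj a.1 b.1) ∨
      (G.Adj a.1 b.1 ∧ H.Adj a.2 b.2))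

/-- Corona product of graphs. -/
def Corona (G : SimpleGraph α) (H : SimpleGraph β) : SimpleGraph (α ⊕ α × β) :=
  SimpleGraph.fromRel (fun a b =>
    match a, b with
    | .inl u, .inl v => G.Adj u v
    | .inl u, .inr (v, _) => u = v
    | .inr (u, w), .inr (v, w') => u = v ∧ H.Adj w w'
    | _, _ => False)

/-- Generalized corona. -/
def GenCorona {n : ℕ} {W : Fin n → Type*} (G : SimpleGraph (Fin n))
    (H : ∀ i, SimpleGraph (W i)) : SimpleGraph (Fin n ⊕ Σ i, W i) :=
  SimpleGraph.fromRel (fun a b =>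
    match a, b with
    | .inl i, .inl j => G.Adj i j
    | .inl i, .inr ⟨j, _⟩ => i = j
    | .inr ⟨i, w⟩, .inr ⟨j, w'⟩ => ∃ h : i = j, (H j).Adj (h ▸ w) w'
    | _, _ => False)

/-- Wheel graph with hub `none` and rim a cycle on `m` vertices. -/
def WheelGraph (m : ℕ) : SimpleGraph (Option (Fin m)) :=
  SimpleGraph.fromRel (fun a b =>
    a = none ∨ ∃ i j, a = some i ∧ b = some j ∧ (cycleGraph m).Adj i j)


theorem ZFClosure.of_closure {G : SimpleGraph V} {B B' : Set V}
    (h : ∀ w ∈ B, ZFClosure G B' w) {v : V} (hv : ZFClosure G B v) : ZFClosure G B' v := by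
  induction hv with
  | init hv => exact h _ hv
  | force _ hadj _ ihu ihw => exact .force ihu hadj ihw

theorem IsZFS.nonempty [Nonempty V] {G : SimpleGraph V} {B : Set V} (h : IsZFS G B) :
    B.Nonempty := by
  by_contra hB
  have key : ∀ v, ZFClosure G B v → False := by
    intro v hv
    induction hv with
    | init hv => exact hB ⟨_, hv⟩
    | force _ _ _ ihu _ => exact ihu
  exact key _ (h (Classical.arbitrary V))

theorem zfNum_le {G : SimpleGraph V} {B : Set V} (h : IsZFS G B) : zfNum G ≤ B.ncard :=
  Nat.sInf_le ⟨B, rfl, h⟩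

theorem exists_isZFS_ncard_eq_zfNum (G : SimpleGraph V) :
    ∃ B : Set V, B.ncard = zfNum G ∧ IsZFS G B :=
  Nat.sInf_mem (s := {k | ∃ B : Set V, B.ncard = k ∧ IsZFS G B})
    ⟨_, Set.univ, rfl, fun _ => .init trivial⟩

/-- If a zero forcing set contains the closed neighborhood of a non-isolated vertex, one
neighbor of that vertex is redundant. -/
theorem zfNum_add_one_le [Finite V] {G : SimpleGraph V} {B : Set V} (h : IsZFS G B) {u x : V}
    (hu : u ∈ B) (hux : G.Adj u x) (hB : ∀ w, G.Adj u w → w ∈ B) : zfNum G + 1 ≤ B.ncard := by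
  have hZ : IsZFS G (B \ {x}) := fun v => (h v).of_closure fun w hw => by
    by_cases hwx : w = x
    · subst hwx
      exact .force (.init ⟨hu, hux.ne⟩) hux fun y hy hyw => .init ⟨hB y hy, hyw⟩
    · exact .init ⟨hw, hwx⟩
  have := zfNum_le hZ
  have := Set.ncard_sdiff_singleton_add_one (hB x hux)
  omega

theorem SimpleGraph.Connected.mem_of_adj_closed {G : SimpleGraph V} (hG : G.Connected)
    {P : V → Prop} (hP : ∀ a b, G.Adj a b → P a → P b) {a : V} (ha : P a) (b : V) : P b := by
  obtain ⟨p⟩ := hG.preconnected a b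
  induction p with
  | nil => exact ha
  | cons hadj _ ih => exact ih (hP _ _ hadj ha)

theorem ncard_sum_sigma {n : ℕ} {W : Fin n → Type*} [∀ i, Fintype (W i)]
    (B : Set (Fin n ⊕ Σ i, W i)) :
    B.ncard = {i | Sum.inl i ∈ B}.ncard + ∑ i, {w | Sum.inr ⟨i, w⟩ ∈ B}.ncard := by
  classical
  simp only [Set.ncard_eq_toFinset_card', Set.toFinset_ofPred, Finset.card_filter]
  rw [← Fintype.sum_sigma', ← Fintype.sum_sum_type (fun x => if x ∈ B then 1 else 0),
    ← Finset.card_filter]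
  congr 1
  ext x
  simp

namespace GenCorona

variable {n : ℕ} {W : Fin n → Type*} {G : SimpleGraph (Fin n)} {H : ∀ i, SimpleGraph (W i)}

theorem adj_inl_inl {i j : Fin n} : (GenCorona G H).Adj (.inl i) (.inl j) ↔ G.Adj i j := by
  simp only [GenCorona, fromRel_adj, ne_eq, Sum.inl.injEq]
  exact ⟨fun h => h.2.elim id fun h => h.symm, fun h => ⟨h.ne, .inl h⟩⟩

theorem adj_inl_inr {i j : Fin n} {w : W j} :
    (GenCorona G H).Adj (.inl i) (.inr ⟨j, w⟩) ↔ i = j := by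
  simp [GenCorona, fromRel_adj]

theorem adj_inr_inl {i j : Fin n} {w : W j} :
    (GenCorona G H).Adj (.inr ⟨j, w⟩) (.inl i) ↔ i = j := by
  rw [adj_comm, adj_inl_inr]

theorem fst_eq_of_adj_inr {i j : Fin n} {w : W i} {w' : W j}
    (h : (GenCorona G H).Adj (.inr ⟨i, w⟩) (.inr ⟨j, w'⟩)) : i = j := by
  simp only [GenCorona, fromRel_adj] at h
  rcases h.2 with ⟨h, _⟩ | ⟨h, _⟩
  · exact h
  · exact h.symm

theorem adj_inr_inr {i : Fin n} {w w' : W i} :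
    (GenCorona G H).Adj (.inr ⟨i, w⟩) (.inr ⟨i, w'⟩) ↔ (H i).Adj w w' := by
  simp only [GenCorona, fromRel_adj, exists_const]
  refine ⟨fun h => h.2.elim id fun h => h.symm,
    fun h => ⟨?_, .inl h⟩⟩
  simpa using h.ne

theorem connected (hG : G.Connected) : (GenCorona G H).Connected := by
  obtain ⟨i₀⟩ := hG.nonempty
  have hr : ∀ j, (GenCorona G H).Reachable (.inl i₀) (.inl j) :=
    hG.mem_of_adj_closed (P := fun j => (GenCorona G H).Reachable (.inl i₀) (.inl j))
      (fun a b hab h => h.trans (adj_inl_inl.2 hab).reachable) (Reachable.refl _)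
  rw [connected_iff_exists_forall_reachable]
  refine ⟨.inl i₀, ?_⟩
  rintro (j | ⟨j, w⟩)
  · exact hr j
  · exact (hr j).trans (adj_inl_inr.2 rfl).reachable

/-- A set containing all of `G` and meeting every copy in a zero forcing set is a connected
zero forcing set. -/
theorem isCZFS (hG : G.Connected) (B : ∀ i, Set (W i)) (hB : ∀ i, IsZFS (H i) (B i)) :
    IsCZFS (GenCorona G H) {x | x.elim (fun _ => True) fun y => y.2 ∈ B y.1} := by
  have hinl : ∀ i, (.inl i : Fin n ⊕ Σ i, W i) ∈
      {x : Fin n ⊕ Σ i, W i | x.elim (fun _ => True) fun y => y.2 ∈ B y.1} := fun _ => trivial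
  obtain ⟨i₀⟩ := hG.nonempty
  refine ⟨?_, fun C => ?_⟩
  · rintro (i | ⟨i, w⟩)
    · exact .init (hinl i)
    · induction hB i w with
      | init hv => exact .init hv
      | force _ hadj _ ihu ihw =>
        refine .force ihu (adj_inr_inr.2 hadj) ?_
        rintro (j | ⟨j, w'⟩) hj hne
        · exact .init (hinl j)
        · obtain rfl := fst_eq_of_adj_inr hj
          exact ihw _ (adj_inr_inr.1 hj) fun h => hne (by rw [h])
  · have hC : C.supp = Set.univ := by
      induction C using ConnectedComponent.ind with
      | h v =>
        ext x
        simpa using (connected hG).preconnected x v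
    rw [hC, Set.inter_univ]
    set S : Set (Fin n ⊕ Σ i, W i) := {x | x.elim (fun _ => True) fun y => y.2 ∈ B y.1}
    have hr : ∀ j, ((GenCorona G H).induce S).Reachable ⟨.inl i₀, hinl i₀⟩ ⟨.inl j, hinl j⟩ :=
      hG.mem_of_adj_closed (P := fun j =>
        ((GenCorona G H).induce S).Reachable ⟨.inl i₀, hinl i₀⟩ ⟨.inl j, hinl j⟩)
        (fun a b hab h => h.trans (Adj.reachable (by simpa using adj_inl_inl.2 hab)))
        (Reachable.refl _)
    rw [connected_iff_exists_forall_reachable]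
    refine ⟨⟨.inl i₀, hinl i₀⟩, ?_⟩
    rintro ⟨j | ⟨j, w⟩, hx⟩
    · exact hr j
    · exact (hr j).trans (Adj.reachable (by simpa using adj_inl_inr.2 rfl))

/-- A zero forcing set of the corona meets every copy in a zero forcing set. -/
theorem isZFS_fiber {i : Fin n} [Nontrivial (W i)] (hH : (H i).Connected)
    {B : Set (Fin n ⊕ Σ i, W i)} (hB : IsZFS (GenCorona G H) B) :
    IsZFS (H i) {w | Sum.inr ⟨i, w⟩ ∈ B} := by
  have key : ∀ x, ZFClosure (GenCorona G H) B x → ∀ w : W i, x = .inr ⟨i, w⟩ →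
      ZFClosure (H i) {w | Sum.inr ⟨i, w⟩ ∈ B} w := by
    intro x hx
    induction hx with
    | init hv =>
      rintro w rfl
      exact .init hv
    | @force u v _ hadj _ ihu ihw =>
      rintro w rfl
      rcases u with j | ⟨j, u⟩
      · obtain rfl := adj_inl_inr.1 hadj
        have hbl : ∀ y, y ≠ w → ZFClosure (H j) {w | Sum.inr ⟨j, w⟩ ∈ B} y := fun y hy =>
          ihw _ (adj_inl_inr.2 rfl) (by simpa using hy) _ rfl
        obtain ⟨y, hy⟩ := hH.preconnected.exists_adj_of_nontrivial w
        exact .force (hbl y hy.ne') hy.symm fun z _ hz => hbl z hz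
      · obtain rfl := fst_eq_of_adj_inr hadj
        exact .force (ihu _ rfl) (adj_inr_inr.1 hadj) fun y hy hyw =>
          ihw _ (adj_inr_inr.2 hy) (by simpa using hyw) _ rfl
  exact fun w => key _ (hB _) w rfl

theorem le_ncard [∀ i, Fintype (W i)] [∀ i, Nontrivial (W i)] (hH : ∀ i, (H i).Connected)
    {B : Set (Fin n ⊕ Σ i, W i)} (hB : IsCZFS (GenCorona G H) B)
    (hconn : (GenCorona G H).Connected) :
    n + ∑ i, zfNum (H i) ≤ B.ncard := by
  have hfib := fun i => isZFS_fiber (hH i) hB.1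
  rw [ncard_sum_sigma]
  by_cases hall : ∀ i, Sum.inl i ∈ B
  · have : {i | (Sum.inl i : Fin n ⊕ Σ i, W i) ∈ B} = Set.univ := Set.eq_univ_of_forall hall
    rw [this, Set.ncard_univ, Nat.card_eq_fintype_card, Fintype.card_fin]
    gcongr with i
    exact zfNum_le (hfib i)
  push Not at hall
  obtain ⟨i, hi⟩ := hall
  have huniq : ∀ j, j = i := by
    intro j
    obtain ⟨a, ha⟩ := (hfib i).nonempty
    obtain ⟨b, hb⟩ := (hfib j).nonempty
    have hC := hB.2 ((GenCorona G H).connectedComponentMk (.inl i))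
    have hsupp : ∀ x, x ∈ ((GenCorona G H).connectedComponentMk (.inl i)).supp := fun x => by
      simpa using hconn.preconnected x (.inl i)
    have := hC.mem_of_adj_closed (P := fun x => ∃ w : W i, x.1 = .inr ⟨i, w⟩) ?_
      (a := ⟨.inr ⟨i, a⟩, ha, hsupp _⟩) ⟨a, rfl⟩ ⟨.inr ⟨j, b⟩, hb, hsupp _⟩
    · obtain ⟨w, hw⟩ := this
      exact congrArg Sigma.fst (Sum.inr_injective hw)
    · rintro ⟨_, _⟩ ⟨k | ⟨k, y⟩, hy, _⟩ hadj ⟨w, rfl⟩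
      · obtain rfl := (adj_inr_inl (G := G) (H := H)).1 hadj
        exact absurd hy hi
      · obtain rfl := fst_eq_of_adj_inr (G := G) (H := H) hadj
        exact ⟨y, rfl⟩
  obtain ⟨u, hu, hnb⟩ : ∃ u : W i, Sum.inr ⟨i, u⟩ ∈ B ∧
      ∀ w, (H i).Adj u w → Sum.inr ⟨i, w⟩ ∈ B := by
    by_contra hno
    push Not at hno
    have key : ∀ x, ZFClosure (GenCorona G H) B x → x ∈ B := by
      intro x hx
      induction hx with
      | init hv => exact hv
      | @force u v _ hadj _ ihu ihw =>
        rcases u with j | ⟨j, u⟩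
        · exact absurd (huniq j ▸ ihu) hi
        obtain rfl := huniq j
        rcases v with k | ⟨k, v⟩
        · obtain ⟨w, hw, hwB⟩ := hno u ihu
          exact absurd (ihw _ (adj_inr_inr.2 hw) (by simp)) hwB
        · exact absurd (ihw _ (adj_inr_inl.2 rfl) (by simp)) hi
    exact hi (key _ (hB.1 _))
  obtain ⟨x, hx⟩ := (hH i).preconnected.exists_adj_of_nontrivial u
  have h1 := zfNum_add_one_le (hfib i) hu hx hnb
  have hsub : Subsingleton (Fin n) := ⟨fun a b => (huniq a).trans (huniq b).symm⟩
  have hn1 : n ≤ 1 := by simpa using Fintype.card_le_one_iff_subsingleton.2 hsub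
  rw [Fintype.sum_subsingleton _ i, Fintype.sum_subsingleton _ i]
  omega

end GenCorona

/-- `Z_c(G⟨H_1,…,H_n⟩) = |V(G)| + ∑ Z(H_i)` for connected `G` and connected
`H_i` with at least two vertices each. -/
theorem stmt12 {n : ℕ} {W : Fin n → Type*} [∀ i, Fintype (W i)]
    [∀ i, Nonempty (W i)] (G : SimpleGraph (Fin n)) (hG : G.Connected)
    (H : ∀ i, SimpleGraph (W i)) (hH : ∀ i, (H i).Connected)
    (hW : ∀ i, 2 ≤ Fintype.card (W i)) :
    czfNum (GenCorona G H) = n + ∑ i, zfNum (H i) := by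
  have hnt : ∀ i, Nontrivial (W i) := fun i => Fintype.one_lt_card_iff_nontrivial.1 (hW i)
  choose B hBc hB using fun i => exists_isZFS_ncard_eq_zfNum (H i)
  have hcz := GenCorona.isCZFS (H := H) hG B hB
  have hmem : n + ∑ i, zfNum (H i) ∈ {k | ∃ B, B.ncard = k ∧ IsCZFS (GenCorona G H) B} := by
    refine ⟨_, ?_, hcz⟩
    rw [ncard_sum_sigma]
    simp [Set.ncard_univ, ← hBc]
    rfl
  refine le_antisymm (Nat.sInf_le hmem) (le_csInf ⟨_, hmem⟩ ?_)
  rintro _ ⟨S, rfl, hS⟩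
  exact GenCorona.le_ncard hH hS (GenCorona.connected hG)
end

section
/- Let G be a connected graph on n ≥ 1 vertices. The following are equivalent: (i) Z_c(G) = 1; (ii) pt_c(G) = n − 1; (iii) PT_c(G) = n − 1; (iv) G is a path. -/
open SimpleGraph

variable {V : Type*} {α β : Type*}

/-- If a zero forcing set lies in a proper subset `S`, some vertex of `S` forces one outside. -/
theorem IsZFS.exists_force {V : Type*} {G : SimpleGraph V} {B S : Set V} (hB : IsZFS G B)
    (hBS : B ⊆ S) (hS : S ≠ Set.univ) :
    ∃ b ∈ S, ∃ x, x ∉ S ∧ G.Adj b x ∧ ∀ y, G.Adj b y → y ∉ S → y = x := by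
  by_contra! hcon
  apply hS
  refine Set.eq_univ_of_forall fun v => ?_
  induction hB v with
  | init h => exact hBS h
  | @force u v _ hadj _ ihu ih =>
    by_contra hv
    obtain ⟨y, hy, hyS, hne⟩ := hcon u ihu v hv hadj
    exact hyS (ih y hy hne)

theorem subset_zfStep_iterate {V : Type*} (G : SimpleGraph V) (B : Set V) (t : ℕ) :
    B ⊆ (zfStep G)^[t] B := by
  induction t with
  | zero => simp
  | succ t ih =>
    rw [Function.iterate_succ_apply']
    exact ih.trans Set.subset_union_left

theorem IsZFS.ncard_add_le {V : Type*} [Finite V] {G : SimpleGraph V} {B : Set V}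
    (hB : IsZFS G B) (t : ℕ) (ht : ∀ s < t, (zfStep G)^[s] B ≠ Set.univ) :
    B.ncard + t ≤ ((zfStep G)^[t] B).ncard := by
  induction t with
  | zero => simp
  | succ t ih =>
    have h1 := ih fun s hs => ht s (by omega)
    rw [Function.iterate_succ_apply']
    obtain ⟨b, hb, x, hx, hadj, huniq⟩ :=
      hB.exists_force (subset_zfStep_iterate G B t) (ht t (by omega))
    have h2 : ((zfStep G)^[t] B).ncard < (zfStep G ((zfStep G)^[t] B)).ncard := by
      apply Set.ncard_lt_ncard _ (Set.toFinite _)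
      refine ⟨Set.subset_union_left, fun h => hx (h (Or.inr ⟨b, hb, hadj, huniq⟩))⟩
    omega

theorem IsZFS.propTime_add_ncard_le {V : Type*} [Fintype V] {G : SimpleGraph V} {B : Set V}
    (hB : IsZFS G B) : propTime G B + B.ncard ≤ Fintype.card V := by
  have h := hB.ncard_add_le (propTime G B) fun s hs => Nat.notMem_of_lt_sInf hs
  have h2 : ((zfStep G)^[propTime G B] B).ncard ≤ Fintype.card V := by
    rw [← Nat.card_eq_fintype_card]
    exact Set.ncard_le_card _
  omega

theorem IsZFS.singleton_iterate {V : Type*} [Fintype V] {G : SimpleGraph V} {v : V}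
    (hB : IsZFS G {v}) (t : ℕ) (ht : t < Fintype.card V) :
    ∃ f : ℕ → V, (zfStep G)^[t] {v} = f '' Set.Iic t ∧ Set.InjOn f (Set.Iic t) ∧
      (∀ i ≤ t, ∀ j ≤ t, G.Adj (f i) (f j) ↔ i + 1 = j ∨ j + 1 = i) ∧
      ∀ i < t, ∀ x, G.Adj (f i) x → x ∈ f '' Set.Iic t := by
  classical
  induction t with
  | zero =>
    refine ⟨fun _ => v, ?_, ?_, ?_, ?_⟩
    · ext; simp
    · intro i hi j hj _
      simp only [Set.mem_Iic] at hi hj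
      omega
    · intro i hi j hj
      simp only [SimpleGraph.irrefl, false_iff]
      omega
    · intro i hi
      omega
  | succ t ih =>
    obtain ⟨f, hS, hinj, hadj, hin⟩ := ih (by omega)
    have hcard : (f '' Set.Iic t).ncard = t + 1 := by
      rw [hinj.ncard_image, ← Finset.coe_Iic, Set.ncard_coe_finset, Nat.card_Iic]
    have hne : f '' Set.Iic t ≠ Set.univ := by
      intro h
      rw [h, Set.ncard_univ, Nat.card_eq_fintype_card] at hcard
      omega
    obtain ⟨b, hb, x, hx, hbx, huniq⟩ :=
      hB.exists_force (hS ▸ subset_zfStep_iterate G {v} t) hne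
    have hlast : ∀ i ≤ t, ∀ y, G.Adj (f i) y → y ∉ f '' Set.Iic t → i = t := by
      intro i hi y hy hyS
      by_contra hit
      exact hyS (hin i (by omega) y hy)
    obtain ⟨i, hi, rfl⟩ := hb
    obtain rfl : i = t := hlast i hi x hbx hx
    have hxf : ∀ j ≤ i, f j ≠ x := fun j hj h => hx ⟨j, hj, h⟩
    have himg : Function.update f (i + 1) x '' Set.Iic (i + 1) = insert x (f '' Set.Iic i) := by
      ext y
      constructor
      · rintro ⟨j, hj, rfl⟩
        rcases Nat.lt_or_ge i j with h | h
        · obtain rfl : j = i + 1 := by simp only [Set.mem_Iic] at hj; omega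
          simp
        · rw [Function.update_of_ne (by omega)]
          exact Or.inr ⟨j, h, rfl⟩
      · rintro (rfl | ⟨j, hj, rfl⟩)
        · exact ⟨i + 1, by simp, by simp⟩
        · simp only [Set.mem_Iic] at hj
          exact ⟨j, by simp only [Set.mem_Iic]; omega, Function.update_of_ne (by omega) _ _⟩
    refine ⟨Function.update f (i + 1) x, ?_, ?_, ?_, ?_⟩
    · rw [himg, Function.iterate_succ_apply', hS]
      ext y
      constructor
      · rintro (hy | ⟨b, ⟨j, hj, rfl⟩, hjy, hju⟩)
        · exact Or.inr hy
        · by_cases hy : y ∈ f '' Set.Iic i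
          · exact Or.inr hy
          · obtain rfl := hlast j hj y hjy hy
            exact Or.inl (huniq y hjy hy)
      · rintro (rfl | hy)
        · exact Or.inr ⟨f i, ⟨i, hi, rfl⟩, hbx, huniq⟩
        · exact Or.inl hy
    · intro j hj k hk hjk
      simp only [Set.mem_Iic] at hj hk
      rcases Nat.lt_or_ge i j with h | h <;> rcases Nat.lt_or_ge i k with h' | h'
      · omega
      · obtain rfl : j = i + 1 := by omega
        rw [Function.update_self, Function.update_of_ne (by omega)] at hjk
        exact absurd hjk.symm (hxf k h')
      · obtain rfl : k = i + 1 := by omega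
        rw [Function.update_self, Function.update_of_ne (by omega)] at hjk
        exact absurd hjk (hxf j h)
      · rw [Function.update_of_ne (by omega), Function.update_of_ne (by omega)] at hjk
        exact hinj h h' hjk
    · have hxadj : ∀ j ≤ i, G.Adj (f j) x ↔ j = i :=
        fun j hj => ⟨fun h => hlast j hj x h hx, fun h => h ▸ hbx⟩
      intro j hj k hk
      rcases Nat.lt_or_ge i j with h | h <;> rcases Nat.lt_or_ge i k with h' | h'
      · obtain rfl : j = i + 1 := by omega
        obtain rfl : k = i + 1 := by omega
        simp
      · obtain rfl : j = i + 1 := by omega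
        rw [Function.update_self, Function.update_of_ne (by omega), G.adj_comm, hxadj k h']
        omega
      · obtain rfl : k = i + 1 := by omega
        rw [Function.update_self, Function.update_of_ne (by omega), hxadj j h]
        omega
      · rw [Function.update_of_ne (by omega), Function.update_of_ne (by omega)]
        exact hadj j h k h'
    · intro j hj y hy
      rw [himg]
      rw [Function.update_of_ne (by omega)] at hy
      by_cases hyS : y ∈ f '' Set.Iic i
      · exact Or.inr hyS
      · obtain rfl := hlast j (by omega) y hy hyS
        exact Or.inl (huniq y hy hyS)

theorem IsZFS.propTime_singleton {V : Type*} [Fintype V] {G : SimpleGraph V} {v : V}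
    (hB : IsZFS G {v}) : propTime G {v} = Fintype.card V - 1 := by
  have hle := hB.propTime_add_ncard_le
  rw [Set.ncard_singleton] at hle
  obtain ⟨f, hS, hinj, -⟩ := hB.singleton_iterate (propTime G {v}) (by omega)
  have hne : {t | (zfStep G)^[t] {v} = Set.univ}.Nonempty := by
    by_contra h
    rw [Set.not_nonempty_iff_eq_empty, Set.eq_empty_iff_forall_notMem] at h
    have h1 := hB.ncard_add_le (Fintype.card V) fun s _ => h s
    have h2 := Set.ncard_le_card ((zfStep G)^[Fintype.card V] {v})
    rw [Set.ncard_singleton] at h1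
    rw [Nat.card_eq_fintype_card] at h2
    omega
  have hfin : (zfStep G)^[propTime G {v}] {v} = Set.univ := Nat.sInf_mem hne
  have hcard := congrArg Set.ncard (hS.symm.trans hfin)
  rw [hinj.ncard_image, ← Finset.coe_Iic, Set.ncard_coe_finset, Nat.card_Iic,
    Set.ncard_univ, Nat.card_eq_fintype_card] at hcard
  omega

theorem IsZFS.nonempty_iso_pathGraph {V : Type*} [Fintype V] {G : SimpleGraph V} {v : V}
    (hB : IsZFS G {v}) : Nonempty (G ≃g pathGraph (Fintype.card V)) := by
  have hpos : 0 < Fintype.card V := Fintype.card_pos_iff.mpr ⟨v⟩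
  obtain ⟨f, -, hinj, hadj, -⟩ := hB.singleton_iterate (Fintype.card V - 1) (by omega)
  have hbij : Function.Bijective fun i : Fin (Fintype.card V) => f i := by
    rw [Fintype.bijective_iff_injective_and_card]
    refine ⟨fun i j hij => Fin.ext (hinj ?_ ?_ hij), by simp⟩ <;> simp only [Set.mem_Iic] <;> omega
  let e : pathGraph (Fintype.card V) ≃g G :=
    { toEquiv := Equiv.ofBijective _ hbij
      map_rel_iff' := by
        intro i j
        rw [pathGraph_adj]
        exact hadj i (by omega) j (by omega) }
  exact ⟨e.symm⟩

theorem isZFS_of_iso_pathGraph {V : Type*} {G : SimpleGraph V} {k : ℕ}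
    (e : G ≃g pathGraph k) (hk : 0 < k) : IsZFS G {e.symm ⟨0, hk⟩} := by
  have key : ∀ n (hn : n < k), ZFClosure G {e.symm ⟨0, hk⟩} (e.symm ⟨n, hn⟩) := by
    intro n
    induction n using Nat.strong_induction_on with
    | _ n ih =>
      intro hn
      rcases n with _ | n
      · exact .init rfl
      · refine .force (u := e.symm ⟨n, by omega⟩) (ih n (by omega) (by omega)) ?_ ?_
        · rw [e.symm.map_adj_iff, pathGraph_adj]
          exact Or.inl rfl
        · intro w hw hne
          obtain ⟨⟨m, hm⟩, rfl⟩ := e.symm.surjective w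
          rw [e.symm.map_adj_iff, pathGraph_adj] at hw
          rcases hw with h | h
          · simp only at h
            subst h
            exact absurd rfl hne
          · simp only at h
            exact ih m (by omega) hm
  intro v
  simpa using key (e v) (e v).isLt

theorem isCZFS_singleton {V : Type*} {G : SimpleGraph V} (hG : G.Connected) {v : V}
    (hB : IsZFS G {v}) : IsCZFS G {v} := by
  refine ⟨hB, fun C => ?_⟩
  have hC : ({v} : Set V) ∩ C.supp = {v} := by
    apply Set.inter_eq_left.mpr
    rintro _ rfl
    induction C using ConnectedComponent.ind with
    | _ w => exact ConnectedComponent.sound (hG.preconnected _ w)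
  rw [hC]
  exact { preconnected := .of_subsingleton, nonempty := ⟨⟨v, rfl⟩⟩ }

theorem isCZFS_univ {V : Type*} (G : SimpleGraph V) : IsCZFS G Set.univ := by
  refine ⟨fun v => .init trivial, fun C => ?_⟩
  rw [Set.univ_inter]
  exact C.connected_toSimpleGraph

theorem exists_isCZFS_ncard_eq_czfNum {V : Type*} (G : SimpleGraph V) :
    ∃ B, B.ncard = czfNum G ∧ IsCZFS G B :=
  Nat.sInf_mem (s := {k | ∃ B : Set V, B.ncard = k ∧ IsCZFS G B})
    ⟨_, Set.univ, rfl, isCZFS_univ G⟩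

theorem IsCZFS.ncard_pos {V : Type*} [Finite V] [Nonempty V] {G : SimpleGraph V} {B : Set V}
    (hB : IsCZFS G B) : 0 < B.ncard := by
  obtain ⟨v⟩ := ‹Nonempty V›
  obtain ⟨x⟩ := (hB.2 (G.connectedComponentMk v)).nonempty
  exact (Set.ncard_pos (Set.toFinite _)).mpr ⟨x.1, x.2.1⟩

theorem czfNum_eq_one_of_propTime {V : Type*} [Fintype V] [Nonempty V] {G : SimpleGraph V}
    (h : ∃ B : Set V, IsCZFS G B ∧ B.ncard = czfNum G ∧ propTime G B = Fintype.card V - 1) :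
    czfNum G = 1 := by
  obtain ⟨B, hB, hcard, ht⟩ := h
  have h1 := hB.1.propTime_add_ncard_le
  have h2 := hB.ncard_pos
  omega

theorem setOf_propTime_eq_singleton {V : Type*} [Fintype V] {G : SimpleGraph V}
    (h : czfNum G = 1) :
    {t | ∃ B : Set V, IsCZFS G B ∧ B.ncard = czfNum G ∧ propTime G B = t} =
      {Fintype.card V - 1} := by
  have key : ∀ B : Set V, IsCZFS G B → B.ncard = czfNum G →
      propTime G B = Fintype.card V - 1 := by
    intro B hB hcard
    obtain ⟨v, rfl⟩ := Set.ncard_eq_one.mp (hcard.trans h)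
    exact hB.1.propTime_singleton
  ext t
  constructor
  · rintro ⟨B, hB, hcard, rfl⟩
    exact key B hB hcard
  · rintro rfl
    obtain ⟨B, hcard, hB⟩ := exists_isCZFS_ncard_eq_czfNum G
    exact ⟨B, hB, hcard, key B hB hcard⟩

/-- For a connected graph `G` the following are equivalent: `Z_c(G) = 1`;
`pt_c(G) = |V(G)| - 1`; `PT_c(G) = |V(G)| - 1`; `G` is a path. -/
theorem stmt18 {V : Type*} [Fintype V] (G : SimpleGraph V) (hG : G.Connected) :
    List.TFAE [czfNum G = 1,
      minCPT G = Fintype.card V - 1,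
      maxCPT G = Fintype.card V - 1,
      ∃ k : ℕ, 1 ≤ k ∧ Nonempty (G ≃g pathGraph k)] := by
  have : Nonempty V := hG.nonempty
  obtain ⟨B₀, hcard₀, hB₀⟩ := exists_isCZFS_ncard_eq_czfNum G
  have hne : {t | ∃ B : Set V, IsCZFS G B ∧ B.ncard = czfNum G ∧ propTime G B = t}.Nonempty :=
    ⟨_, B₀, hB₀, hcard₀, rfl⟩
  tfae_have 1 → 2 := by
    intro h
    rw [minCPT, setOf_propTime_eq_singleton h, csInf_singleton]
  tfae_have 1 → 3 := by
    intro h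
    rw [maxCPT, setOf_propTime_eq_singleton h, csSup_singleton]
  tfae_have 2 → 1 := fun h => czfNum_eq_one_of_propTime (h ▸ Nat.sInf_mem hne)
  tfae_have 3 → 1 := by
    refine fun h => czfNum_eq_one_of_propTime (h ▸ Nat.sSup_mem hne ⟨Fintype.card V, ?_⟩)
    rintro _ ⟨B, hB, -, rfl⟩
    exact le_of_add_le_left hB.1.propTime_add_ncard_le
  tfae_have 1 → 4 := by
    intro h
    obtain ⟨v, rfl⟩ := Set.ncard_eq_one.mp (hcard₀.trans h)
    exact ⟨_, Fintype.card_pos, hB₀.1.nonempty_iso_pathGraph⟩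
  tfae_have 4 → 1 := by
    rintro ⟨k, hk, ⟨e⟩⟩
    have hle : czfNum G ≤ 1 :=
      Nat.sInf_le ⟨_, Set.ncard_singleton _, isCZFS_singleton hG (isZFS_of_iso_pathGraph e hk)⟩
    have := hB₀.ncard_pos
    omega
  tfae_finish
end
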